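/- Every tail measure ν with index α > 0 on E^ℤ admits a stochastic representation: there exists a probability measure σ on E^ℤ (the law of a process Z) such that σ({0}) = 0, ∫ ‖x_0‖^α σ(dx) = 1, ∫ ‖x_h‖^α σ(dx) < ∞ for all h ∈ ℤ, and ν(A) = ∫_0^∞ σ({x : r x ∈ A}) α r^{−α−1} dr for every measurable A. -/

import Mathlib

open MeasureTheory
open scoped ENNReal

/-- A measurable cone: a measurable space `E` with a measurable multiplication by positive
scalars, a zero element and a measurable `1`-homogeneous pseudonorm. -/
structure MeasCone (E : Type*) [MeasurableSpace E] where
  smul : ℝ → E → E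
  zero : E
  nrm : E → ℝ
  measurable_smul : Measurable fun p : ℝ × E => smul p.1 p.2
  measurable_nrm : Measurable nrm
  one_smul : ∀ x, smul 1 x = x
  smul_smul : ∀ (u v : ℝ), 0 < u → 0 < v → ∀ x, smul u (smul v x) = smul (u * v) x
  smul_zero' : ∀ (u : ℝ), 0 < u → smul u zero = zero
  nrm_nonneg : ∀ x, 0 ≤ nrm x
  nrm_smul : ∀ (u : ℝ), 0 < u → ∀ x, nrm (smul u x) = u * nrm x
  eq_zero_of_nrm : ∀ x, nrm x = 0 → x = zero

/-- The `k`-th iterate of the backshift operator: `(B^k x)_h = x_{h-k}`. -/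
def seqShift {E : Type*} (k : ℤ) (x : ℤ → E) : ℤ → E := fun h => x (h - k)

/-- Shift invariance of a measure on `E^ℤ`: `ν(BA) = ν(A)` for all measurable `A`. -/
def ShiftInvariant {E : Type*} [MeasurableSpace E] (ν : MeasureTheory.Measure (ℤ → E)) : Prop :=
  ∀ A : Set (ℤ → E), MeasurableSet A → ν (seqShift 1 '' A) = ν A

namespace MeasCone

variable {E : Type*} [MeasurableSpace E] (K : MeasCone E)

/-- The sequence identically equal to the zero element. -/
def zeroSeq : ℤ → E := fun _ => K.zero

/-- Componentwise scalar multiplication on the sequence space `E^ℤ`. -/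
def sSmul (u : ℝ) (x : ℤ → E) : ℤ → E := fun h => K.smul u (x h)


/-- A tail measure with index `α > 0` on `E^ℤ`. -/
def IsTailMeasure (α : ℝ) (ν : Measure (ℤ → E)) : Prop :=
  ν {K.zeroSeq} = 0 ∧
  ν {x | 1 < K.nrm (x 0)} = 1 ∧
  (∀ h : ℤ, ν {x | 1 < K.nrm (x h)} < ⊤) ∧
  ∀ (u : ℝ), 0 < u → ∀ A : Set (ℤ → E), MeasurableSet A →
    ν (K.sSmul u '' A) = ENNReal.ofReal (u ^ (-α)) * ν A

/-- The spectral map at lag `h`: `x ↦ x / ‖x_h‖`. -/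
noncomputable def spectralMap (h : ℤ) (x : ℤ → E) : ℤ → E :=
  fun j => K.smul (K.nrm (x h))⁻¹ (x j)

/-- The law of the local spectral tail process of `ν` at lag `h`:
the pushforward under the spectral map of (the normalization of) the restriction of `ν`
to `{x : ‖x_h‖ > 1}`. -/
noncomputable def spectralLaw (ν : Measure (ℤ → E)) (h : ℤ) : Measure (ℤ → E) :=
  Measure.map (K.spectralMap h)
    ((ν {x | 1 < K.nrm (x h)})⁻¹ • ν.restrict {x | 1 < K.nrm (x h)})

/-- The time change formula for (the law of) a process `Θ`:
`E[H₀(B^h Θ)] = E[‖Θ_h‖^α H₀(Θ)]` for every measurable `0`-homogeneous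
`H₀ : E^ℤ → [0,∞)` vanishing on `{x : ‖x_0‖ = 0}`. -/
def SatisfiesTCF (α : ℝ) (μ : Measure (ℤ → E)) : Prop :=
  ∀ (h : ℤ) (H : (ℤ → E) → ℝ), Measurable H → (∀ x, 0 ≤ H x) →
    (∀ (u : ℝ), 0 < u → ∀ x, H (K.sSmul u x) = H x) →
    (∀ x, K.nrm (x 0) = 0 → H x = 0) →
    ∫⁻ x, ENNReal.ofReal (H (seqShift h x)) ∂μ
      = ∫⁻ x, ENNReal.ofReal (K.nrm (x h) ^ α) * ENNReal.ofReal (H x) ∂μ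

/-- `I(x) = j ∈ ℤ` for the infargmax functional:
`sup_{k ≤ j-1} ‖x_k‖ < ‖x_j‖ = sup_{k ∈ ℤ} ‖x_k‖`. -/
def IsInfArgmax (x : ℤ → E) (j : ℤ) : Prop :=
  (⨆ k : ℤ, ⨆ _ : k < j, ENNReal.ofReal (K.nrm (x k))) < ENNReal.ofReal (K.nrm (x j)) ∧
  ENNReal.ofReal (K.nrm (x j)) = ⨆ k : ℤ, ENNReal.ofReal (K.nrm (x k))

end MeasCone

namespace MeasCone

variable {E : Type*} [MeasurableSpace E] (K : MeasCone E)

lemma measurable_sSmul_uncurry :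
    Measurable fun p : ℝ × (ℤ → E) => K.sSmul p.1 p.2 :=
  measurable_pi_lambda _ fun h => K.measurable_smul.comp
    (measurable_fst.prodMk ((measurable_pi_apply h).comp measurable_snd))

lemma measurable_sSmul (u : ℝ) : Measurable (K.sSmul u) :=
  K.measurable_sSmul_uncurry.comp (measurable_const.prodMk measurable_id)

lemma measurable_nrm_apply (h : ℤ) : Measurable fun x : ℤ → E => K.nrm (x h) :=
  K.measurable_nrm.comp (measurable_pi_apply h)

lemma sSmul_inv_sSmul {u : ℝ} (hu : 0 < u) (x : ℤ → E) : K.sSmul u⁻¹ (K.sSmul u x) = x := by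
  funext h
  simp only [sSmul]
  rw [K.smul_smul _ _ (inv_pos.2 hu) hu, inv_mul_cancel₀ hu.ne', K.one_smul]

lemma image_sSmul {u : ℝ} (hu : 0 < u) (A : Set (ℤ → E)) :
    K.sSmul u '' A = K.sSmul u⁻¹ ⁻¹' A := by
  refine congrFun (Set.image_eq_preimage_of_inverse (K.sSmul_inv_sSmul hu) fun x => ?_) A
  simpa using K.sSmul_inv_sSmul (inv_pos.2 hu) x

variable {K} {α : ℝ} {ν : Measure (ℤ → E)}

lemma IsTailMeasure.measure_preimage_sSmul (hν : K.IsTailMeasure α ν) {u : ℝ} (hu : 0 < u)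
    {A : Set (ℤ → E)} (hA : MeasurableSet A) :
    ν (K.sSmul u ⁻¹' A) = ENNReal.ofReal (u ^ α) * ν A := by
  have h := hν.2.2.2 u⁻¹ (inv_pos.2 hu) A hA
  rwa [K.image_sSmul (inv_pos.2 hu), inv_inv, Real.inv_rpow hu.le, Real.rpow_neg hu.le,
    inv_inv] at h

lemma IsTailMeasure.lintegral_comp_sSmul (hν : K.IsTailMeasure α ν) {u : ℝ} (hu : 0 < u)
    {f : (ℤ → E) → ℝ≥0∞} (hf : Measurable f) :
    ∫⁻ x, f (K.sSmul u x) ∂ν = ENNReal.ofReal (u ^ α) * ∫⁻ x, f x ∂ν := by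
  have hmap : ν.map (K.sSmul u) = ENNReal.ofReal (u ^ α) • ν := by
    ext A hA
    rw [Measure.map_apply (K.measurable_sSmul u) hA, hν.measure_preimage_sSmul hu hA]
    rfl
  rw [← lintegral_map hf (K.measurable_sSmul u), hmap, lintegral_smul_measure, smul_eq_mul]

lemma IsTailMeasure.ae_exists_nrm_pos (hν : K.IsTailMeasure α ν) :
    ∀ᵐ x ∂ν, ∃ h, 0 < K.nrm (x h) := by
  have h0 : ∀ᵐ x ∂ν, x ≠ K.zeroSeq := by
    rw [ae_iff]
    simpa using hν.1
  filter_upwards [h0] with x hx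
  by_contra! hc
  exact hx (funext fun h => K.eq_zero_of_nrm _ (le_antisymm (hc h) (K.nrm_nonneg _)))

/-- A radial function for `ν`: measurable, `1`-homogeneous, `ν`-almost everywhere positive,
and with `ν {x | 1 < τ x} < ∞`. -/
structure IsRadial (K : MeasCone E) (ν : Measure (ℤ → E)) (τ : (ℤ → E) → ℝ) : Prop where
  measurable : Measurable τ
  nonneg : ∀ x, 0 ≤ τ x
  homogeneous : ∀ u : ℝ, 0 < u → ∀ x, τ (K.sSmul u x) = u * τ x
  ae_pos : ∀ᵐ x ∂ν, 0 < τ x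
  measure_lt_top : ν {x | 1 < τ x} < ∞

lemma IsTailMeasure.exists_isRadial (hν : K.IsTailMeasure α ν) (hα : 0 < α) :
    ∃ τ, IsRadial K ν τ := by
  obtain ⟨ε, hε, hεsum⟩ := ENNReal.exists_pos_sum_of_countable one_ne_zero ℤ
  let p : ℤ → ℝ := fun h => (ν {x | 1 < K.nrm (x h)}).toReal
  have hp : ∀ h, 0 ≤ p h := fun h => ENNReal.toReal_nonneg
  let b : ℤ → ℝ := fun h => ε h / (p h + 1)
  have hb : ∀ h, 0 < b h := fun h => div_pos (NNReal.coe_pos.2 (hε h)) (by linarith [hp h])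
  let w : ℤ → ℝ := fun h => b h ^ α⁻¹
  have hw : ∀ h, 0 < w h := fun h => Real.rpow_pos_of_pos (hb h) _
  let s : (ℤ → E) → ℝ≥0∞ := fun x => ⨆ h, ENNReal.ofReal (w h * K.nrm (x h))
  have hs : Measurable s := Measurable.iSup fun h =>
    ((K.measurable_nrm_apply h).const_mul (w h)).ennreal_ofReal
  have hs_smul : ∀ u : ℝ, 0 < u → ∀ x, s (K.sSmul u x) = ENNReal.ofReal u * s x := by
    intro u hu x
    simp only [s, sSmul, ENNReal.mul_iSup]
    refine iSup_congr fun h => ?_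
    rw [K.nrm_smul u hu, ← ENNReal.ofReal_mul hu.le]
    ring_nf
  have hs_top : ν {x | 1 < s x} < ∞ := by
    have hsub : {x | 1 < s x} ⊆ ⋃ h, K.sSmul (w h) ⁻¹' {x | 1 < K.nrm (x h)} := by
      intro x hx
      obtain ⟨h, hh⟩ := lt_iSup_iff.1 (show 1 < s x from hx)
      refine Set.mem_iUnion.2 ⟨h, ?_⟩
      rw [ENNReal.one_lt_ofReal] at hh
      simpa [sSmul, K.nrm_smul _ (hw h)] using hh
    refine (measure_mono hsub).trans_lt ((measure_iUnion_le _).trans_lt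
      (lt_of_le_of_lt (ENNReal.tsum_le_tsum fun h => ?_) (hεsum.trans ENNReal.one_lt_top)))
    rw [hν.measure_preimage_sSmul (hw h)
      (measurableSet_lt measurable_const (K.measurable_nrm_apply h)),
      ← ENNReal.ofReal_toReal (hν.2.2.1 h).ne,
      ← ENNReal.ofReal_mul (Real.rpow_nonneg (hw h).le _), ← ENNReal.ofReal_coe_nnreal]
    refine ENNReal.ofReal_le_ofReal ?_
    simp only [w]
    rw [Real.rpow_inv_rpow (hb h).le hα.ne']
    change ε h / (p h + 1) * p h ≤ ε h
    have := hp h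
    rw [div_mul_eq_mul_div, div_le_iff₀ (by linarith)]
    nlinarith [(ε h).coe_nonneg]
  have hs_ae : ∀ᵐ x ∂ν, s x ≠ ∞ := by
    rw [ae_iff]
    simp only [not_not]
    have hle : ν {x | s x = ∞} < ∞ := by
      refine (measure_mono fun x hx => ?_).trans_lt hs_top
      rw [Set.mem_ofPred_eq] at hx ⊢
      rw [hx]
      exact ENNReal.one_lt_top
    have hu : (0 : ℝ) < 2 ^ α⁻¹ := by positivity
    have h := hν.measure_preimage_sSmul hu (measurableSet_eq_fun hs measurable_const)
      (A := {x | s x = ∞})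
    have hpre : K.sSmul (2 ^ α⁻¹) ⁻¹' {x | s x = ∞} = {x | s x = ∞} := by
      ext x
      simp [hs_smul _ hu, ENNReal.mul_eq_top, hu]
    rw [hpre, Real.rpow_inv_rpow two_pos.le hα.ne'] at h
    have h' := congrArg ENNReal.toReal h
    rw [ENNReal.toReal_mul, ENNReal.toReal_ofReal two_pos.le] at h'
    have h0 : (ν {x | s x = ∞}).toReal = 0 := by linarith
    exact ((ENNReal.toReal_eq_zero_iff _).1 h0).resolve_right hle.ne
  refine ⟨fun x => (s x).toReal, hs.ennreal_toReal, fun x => ENNReal.toReal_nonneg,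
    fun u hu x => ?_, ?_, ?_⟩
  · rw [hs_smul u hu, ENNReal.toReal_mul, ENNReal.toReal_ofReal hu.le]
  · filter_upwards [hs_ae, hν.ae_exists_nrm_pos] with x hx ⟨h, hh⟩
    refine ENNReal.toReal_pos ?_ hx
    refine (lt_of_lt_of_le ?_ (le_iSup (fun h => ENNReal.ofReal (w h * K.nrm (x h))) h)).ne'
    exact ENNReal.ofReal_pos.2 (mul_pos (hw h) hh)
  · refine (measure_mono fun x hx => ?_).trans_lt hs_top
    rw [Set.mem_ofPred_eq] at hx ⊢
    by_cases ht : s x = ∞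
    · rw [ht]; exact ENNReal.one_lt_top
    · rw [← ENNReal.ofReal_toReal ht]
      exact ENNReal.one_lt_ofReal.2 hx

lemma IsRadial.const_mul {τ : (ℤ → E) → ℝ} (hτ : IsRadial K ν τ) (hν : K.IsTailMeasure α ν)
    {c : ℝ} (hc : 0 < c) : IsRadial K ν fun x => c * τ x where
  measurable := hτ.measurable.const_mul c
  nonneg x := mul_nonneg hc.le (hτ.nonneg x)
  homogeneous u hu x := by rw [hτ.homogeneous u hu]; ring
  ae_pos := hτ.ae_pos.mono fun x hx => mul_pos hc hx
  measure_lt_top := by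
    simp_rw [← hτ.homogeneous c hc]
    exact (hν.measure_preimage_sSmul hc (measurableSet_lt measurable_const hτ.measurable)).trans_lt
      (ENNReal.mul_lt_top ENNReal.ofReal_lt_top hτ.measure_lt_top)

lemma IsRadial.sigmaFinite {τ : (ℤ → E) → ℝ} (hτ : IsRadial K ν τ)
    (hν : K.IsTailMeasure α ν) : SigmaFinite ν := by
  refine Measure.sigmaFinite_of_countable (Set.countable_range
    fun n : ℕ => {x | 1 < ((n : ℝ) + 1) * τ x} ∪ {x | ¬ 0 < τ x}) ?_ ?_
  · rintro _ ⟨n, rfl⟩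
    refine (measure_union_le _ _).trans_lt ?_
    rw [ae_iff.1 hτ.ae_pos, add_zero]
    exact (hτ.const_mul hν (by positivity : (0 : ℝ) < n + 1)).measure_lt_top
  · refine Set.eq_univ_of_forall fun x => ?_
    by_cases hx : 0 < τ x
    · obtain ⟨n, hn⟩ := exists_nat_gt (τ x)⁻¹
      refine Set.mem_sUnion.2 ⟨_, ⟨n, rfl⟩, Or.inl ?_⟩
      have := mul_lt_mul_of_pos_right hn hx
      rw [inv_mul_cancel₀ hx.ne'] at this
      change 1 < ((n : ℝ) + 1) * τ x
      nlinarith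
    · exact Set.mem_sUnion.2 ⟨_, ⟨0, rfl⟩, Or.inr hx⟩

/-- The density with respect to a tail measure of the representing law attached to `τ`. -/
noncomputable def radialDensity (α : ℝ) (τ : (ℤ → E) → ℝ) (x : ℤ → E) : ℝ≥0∞ :=
  {x | 1 < τ x}.indicator (fun x => ENNReal.ofReal (τ x ^ (-α))) x

lemma IsRadial.measurable_radialDensity {τ : (ℤ → E) → ℝ} (hτ : IsRadial K ν τ) :
    Measurable (radialDensity α τ) :=
  (hτ.measurable.pow_const _).ennreal_ofReal.indicator
    (measurableSet_lt measurable_const hτ.measurable)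

lemma IsRadial.lintegral_radialDensity_lt_top {τ : (ℤ → E) → ℝ} (hτ : IsRadial K ν τ)
    (hα : 0 < α) : ∫⁻ x, radialDensity α τ x ∂ν < ∞ := by
  simp only [radialDensity]
  rw [lintegral_indicator (measurableSet_lt measurable_const hτ.measurable)]
  refine (setLIntegral_mono measurable_const fun x hx => ?_).trans_lt
    (setLIntegral_one {x | 1 < τ x} ▸ hτ.measure_lt_top)
  rw [ENNReal.ofReal_le_one]
  exact Real.rpow_le_one_of_one_le_of_nonpos (le_of_lt hx) (by linarith)

lemma lintegral_Ioo_zero_mul_rpow (hα : 0 < α) {t : ℝ} (ht : 0 < t) :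
    ∫⁻ r in Set.Ioo 0 t, ENNReal.ofReal (α * r ^ (α - 1)) = ENNReal.ofReal (t ^ α) := by
  have hint : IntervalIntegrable (fun r : ℝ => α * r ^ (α - 1)) volume 0 t :=
    (intervalIntegral.intervalIntegrable_rpow' (by linarith)).const_mul α
  rw [restrict_Ioo_eq_restrict_Ioc, ← ofReal_integral_eq_lintegral_ofReal
    ((intervalIntegrable_iff_integrableOn_Ioc_of_le ht.le).1 hint),
    ← intervalIntegral.integral_of_le ht.le, intervalIntegral.integral_const_mul,
    integral_rpow (Or.inl (by linarith))]
  · rw [sub_add_cancel, Real.zero_rpow hα.ne', sub_zero, mul_div_cancel₀ _ hα.ne']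
  · filter_upwards [ae_restrict_mem measurableSet_Ioc] with r hr
    exact mul_nonneg hα.le (Real.rpow_nonneg hr.1.le _)

lemma lintegral_Ioi_mul_rpow (hα : 0 < α) {t : ℝ} (ht : 0 < t) :
    ∫⁻ r in Set.Ioi t, ENNReal.ofReal (α * r ^ (-α - 1)) = ENNReal.ofReal (t ^ (-α)) := by
  rw [← ofReal_integral_eq_lintegral_ofReal
    ((integrableOn_Ioi_rpow_of_lt (by linarith) ht).const_mul α), integral_const_mul,
    integral_Ioi_rpow_of_lt (by linarith) ht]
  · congr 1
    rw [show -α - 1 + 1 = -α by ring]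
    field_simp
  · filter_upwards [ae_restrict_mem measurableSet_Ioi] with r hr
    exact mul_nonneg hα.le (Real.rpow_nonneg (ht.trans hr).le _)

lemma IsRadial.lintegral_radialDensity_ray {τ : (ℤ → E) → ℝ} (hτ : IsRadial K ν τ)
    (hα : 0 < α) {x : ℤ → E} (hx : 0 < τ x) :
    ∫⁻ r in Set.Ioi (0 : ℝ), ENNReal.ofReal (α * r⁻¹) * radialDensity α τ (K.sSmul r⁻¹ x) = 1 := by
  have hcongr : ∀ r ∈ Set.Ioi (0 : ℝ),
      ENNReal.ofReal (α * r⁻¹) * radialDensity α τ (K.sSmul r⁻¹ x)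
        = (Set.Iio (τ x)).indicator
          (fun r => ENNReal.ofReal (τ x ^ (-α)) * ENNReal.ofReal (α * r ^ (α - 1))) r := by
    intro r hr
    have hr : 0 < r := hr
    have hlt : 1 < r⁻¹ * τ x ↔ r < τ x := by
      rw [inv_mul_eq_div, one_lt_div hr]
    simp only [radialDensity, Set.indicator_apply, Set.mem_ofPred_eq,
      hτ.homogeneous _ (inv_pos.2 hr), hlt, Set.mem_Iio]
    split_ifs
    · rw [← ENNReal.ofReal_mul (by positivity), ← ENNReal.ofReal_mul (by positivity),
        Real.mul_rpow (inv_pos.2 hr).le hx.le, Real.inv_rpow hr.le, Real.rpow_neg hr.le, inv_inv,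
        Real.rpow_sub_one hr.ne']
      congr 1
      ring
    · simp
  rw [setLIntegral_congr_fun measurableSet_Ioi hcongr, lintegral_indicator measurableSet_Iio,
    Measure.restrict_restrict measurableSet_Iio, Set.inter_comm, Set.Ioi_inter_Iio,
    lintegral_const_mul _ (by fun_prop), lintegral_Ioo_zero_mul_rpow hα hx,
    ← ENNReal.ofReal_mul (by positivity), ← Real.rpow_add hx]
  simp

lemma IsRadial.measure_eq_lintegral {τ : (ℤ → E) → ℝ} (hτ : IsRadial K ν τ)
    (hν : K.IsTailMeasure α ν) (hα : 0 < α) {A : Set (ℤ → E)} (hA : MeasurableSet A) :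
    ν A = ∫⁻ r in Set.Ioi (0 : ℝ),
      ν.withDensity (radialDensity α τ) {x | K.sSmul r x ∈ A}
        * ENNReal.ofReal (α * r ^ (-α - 1)) := by
  have := hτ.sigmaFinite hν
  have hk := hτ.measurable_radialDensity (α := α)
  have hcongr : ∀ r ∈ Set.Ioi (0 : ℝ),
      ν.withDensity (radialDensity α τ) {x | K.sSmul r x ∈ A} * ENNReal.ofReal (α * r ^ (-α - 1))
        = ∫⁻ x in A, ENNReal.ofReal (α * r⁻¹) * radialDensity α τ (K.sSmul r⁻¹ x) ∂ν := by
    intro r hr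
    have hr : 0 < r := hr
    have hkr : Measurable fun x => radialDensity α τ (K.sSmul r⁻¹ x) :=
      hk.comp (K.measurable_sSmul _)
    have hAr : MeasurableSet {x | K.sSmul r x ∈ A} := K.measurable_sSmul r hA
    have hcomp := hν.lintegral_comp_sSmul hr (hkr.indicator hA)
    rw [lintegral_indicator hA] at hcomp
    have hmass : ν.withDensity (radialDensity α τ) {x | K.sSmul r x ∈ A}
        = ENNReal.ofReal (r ^ α) * ∫⁻ x in A, radialDensity α τ (K.sSmul r⁻¹ x) ∂ν := by
      rw [withDensity_apply _ hAr, ← lintegral_indicator hAr, ← hcomp]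
      refine lintegral_congr fun x => ?_
      classical
      simp only [Set.indicator_apply, Set.mem_ofPred_eq, K.sSmul_inv_sSmul hr]
    rw [hmass, lintegral_const_mul _ hkr, mul_right_comm, ← ENNReal.ofReal_mul (by positivity)]
    congr 2
    rw [mul_left_comm, ← Real.rpow_add hr, ← Real.rpow_neg_one]
    ring_nf
  rw [setLIntegral_congr_fun measurableSet_Ioi hcongr, lintegral_lintegral_swap]
  · rw [← setLIntegral_one]
    refine lintegral_congr_ae ?_
    filter_upwards [ae_restrict_of_ae hτ.ae_pos] with x hx
    exact (hτ.lintegral_radialDensity_ray hα hx).symm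
  · refine Measurable.aemeasurable (Measurable.mul (by fun_prop) (hk.comp ?_))
    exact K.measurable_sSmul_uncurry.comp (measurable_fst.inv.prodMk measurable_snd)

lemma lintegral_nrm_rpow_eq (K : MeasCone E) (hα : 0 < α) (σ : Measure (ℤ → E)) [SFinite σ]
    (h : ℤ) :
    ∫⁻ x, ENNReal.ofReal (K.nrm (x h) ^ α) ∂σ
      = ∫⁻ r in Set.Ioi (0 : ℝ), σ {x | K.sSmul r x ∈ {x | 1 < K.nrm (x h)}}
          * ENNReal.ofReal (α * r ^ (-α - 1)) := by
  have hS : MeasurableSet {p : ℝ × (ℤ → E) | 1 < p.1 * K.nrm (p.2 h)} :=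
    measurableSet_lt measurable_const
      (measurable_fst.mul ((K.measurable_nrm_apply h).comp measurable_snd))
  have hcongr : ∀ r ∈ Set.Ioi (0 : ℝ),
      σ {x | K.sSmul r x ∈ {x | 1 < K.nrm (x h)}} * ENNReal.ofReal (α * r ^ (-α - 1))
        = ∫⁻ x, {p : ℝ × (ℤ → E) | 1 < p.1 * K.nrm (p.2 h)}.indicator
            (fun p => ENNReal.ofReal (α * p.1 ^ (-α - 1))) (r, x) ∂σ := by
    intro r hr
    have hm : MeasurableSet {x : ℤ → E | 1 < r * K.nrm (x h)} :=
      measurableSet_lt measurable_const ((K.measurable_nrm_apply h).const_mul r)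
    have hset : {x | K.sSmul r x ∈ {x | 1 < K.nrm (x h)}} = {x | 1 < r * K.nrm (x h)} := by
      ext x
      simp [sSmul, K.nrm_smul r hr]
    rw [hset, mul_comm, ← lintegral_indicator_const hm]
    rfl
  rw [setLIntegral_congr_fun measurableSet_Ioi hcongr, lintegral_lintegral_swap]
  · refine lintegral_congr fun x => ?_
    rcases (K.nrm_nonneg (x h)).eq_or_lt with h0 | h0
    · simp [← h0, Real.zero_rpow hα.ne']
    · have hind : ∀ r : ℝ, {p : ℝ × (ℤ → E) | 1 < p.1 * K.nrm (p.2 h)}.indicator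
            (fun p => ENNReal.ofReal (α * p.1 ^ (-α - 1))) (r, x)
          = (Set.Ioi (K.nrm (x h))⁻¹).indicator
            (fun r => ENNReal.ofReal (α * r ^ (-α - 1))) r := by
        intro r
        simp only [Set.indicator_apply, Set.mem_ofPred_eq, Set.mem_Ioi, inv_lt_iff_one_lt_mul₀ h0]
      simp_rw [hind]
      rw [lintegral_indicator measurableSet_Ioi, Measure.restrict_restrict measurableSet_Ioi,
        Set.inter_eq_left.2 (Set.Ioi_subset_Ioi (inv_pos.2 h0).le),
        lintegral_Ioi_mul_rpow hα (inv_pos.2 h0), Real.inv_rpow h0.le, Real.rpow_neg h0.le,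
        inv_inv]
  · exact (Measurable.indicator (by fun_prop) hS).aemeasurable

lemma IsTailMeasure.exists_isRadial_lintegral_eq_one (hν : K.IsTailMeasure α ν) (hα : 0 < α) :
    ∃ τ, IsRadial K ν τ ∧ ∫⁻ x, radialDensity α τ x ∂ν = 1 := by
  obtain ⟨τ, hτ⟩ := hν.exists_isRadial hα
  set M := ∫⁻ x, radialDensity α τ x ∂ν with hM
  have hM_top : M ≠ ∞ := (hτ.lintegral_radialDensity_lt_top hα).ne
  have hM_zero : M ≠ 0 := by
    intro h0
    have hσ : ν.withDensity (radialDensity α τ) = 0 := by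
      rw [← Measure.measure_univ_eq_zero, withDensity_apply _ MeasurableSet.univ,
        Measure.restrict_univ, ← hM, h0]
    have h1 := hτ.measure_eq_lintegral hν hα
      (A := {x | 1 < K.nrm (x 0)}) (measurableSet_lt measurable_const (K.measurable_nrm_apply 0))
    rw [hν.2.1, hσ] at h1
    simp at h1
  have hM_pos : 0 < M.toReal := ENNReal.toReal_pos hM_zero hM_top
  have hc : 0 < M.toReal⁻¹ ^ α⁻¹ := by positivity
  refine ⟨_, hτ.const_mul hν hc, ?_⟩
  have hcomp : ∀ x, radialDensity α (fun x => M.toReal⁻¹ ^ α⁻¹ * τ x) x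
      = radialDensity α τ (K.sSmul (M.toReal⁻¹ ^ α⁻¹) x) := by
    intro x
    simp only [radialDensity, Set.indicator_apply, Set.mem_ofPred_eq, hτ.homogeneous _ hc]
  simp_rw [hcomp]
  rw [hν.lintegral_comp_sSmul hc hτ.measurable_radialDensity, ← hM,
    Real.rpow_inv_rpow (inv_pos.2 hM_pos).le hα.ne', ENNReal.ofReal_inv_of_pos hM_pos,
    ENNReal.ofReal_toReal hM_top, ENNReal.inv_mul_cancel hM_zero hM_top]

end MeasCone

open MeasCone in
/-- every tail measure admits a stochastic representation
`ν(A) = ∫_0^∞ σ({x : r x ∈ A}) α r^{-α-1} dr` for some probability law `σ` with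
`σ({0}) = 0`, `∫ ‖x_0‖^α dσ = 1` and `∫ ‖x_h‖^α dσ < ∞`. -/
theorem exists_stochasticRep_of_isTailMeasure
    {E : Type*} [MeasurableSpace E] (K : MeasCone E) (α : ℝ) (hα : 0 < α)
    (ν : Measure (ℤ → E)) (hν : K.IsTailMeasure α ν) :
    ∃ σm : Measure (ℤ → E), IsProbabilityMeasure σm ∧
      σm {K.zeroSeq} = 0 ∧
      (∫⁻ x, ENNReal.ofReal (K.nrm (x 0) ^ α) ∂σm) = 1 ∧
      (∀ h : ℤ, ∫⁻ x, ENNReal.ofReal (K.nrm (x h) ^ α) ∂σm < ⊤) ∧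
      ∀ A : Set (ℤ → E), MeasurableSet A →
        ν A = ∫⁻ r in Set.Ioi (0 : ℝ),
          σm {x | K.sSmul r x ∈ A} * ENNReal.ofReal (α * r ^ (-α - 1)) ∂volume := by
  obtain ⟨τ, hτ, hτ_one⟩ := hν.exists_isRadial_lintegral_eq_one hα
  have hprob : IsProbabilityMeasure (ν.withDensity (radialDensity α τ)) :=
    ⟨by rw [withDensity_apply _ MeasurableSet.univ, Measure.restrict_univ, hτ_one]⟩
  have hrep := fun A hA => hτ.measure_eq_lintegral hν hα (A := A) hA
  have hmoment : ∀ h : ℤ,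
      ∫⁻ x, ENNReal.ofReal (K.nrm (x h) ^ α) ∂(ν.withDensity (radialDensity α τ))
        = ν {x | 1 < K.nrm (x h)} := fun h => by
    rw [lintegral_nrm_rpow_eq K hα,
      ← hrep _ (measurableSet_lt measurable_const (K.measurable_nrm_apply h))]
  exact ⟨_, hprob, withDensity_absolutelyContinuous _ _ hν.1, (hmoment 0).trans hν.2.1,
    fun h => (hmoment h).trans_lt (hν.2.2.1 h), hrep⟩
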